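/- Let n ≥ 2, 0 < s < n, and 0 < λ < 1, and let Ω₊ = {z ∈ ℂⁿ : b_{s,n}(z,z) > 0}/G_λ with the quotient topology. Then for any basepoint x ∈ Ω₊, the fundamental group π₁(Ω₊, x) is isomorphic to ℤ if s < n−1, and is isomorphic to ℤ × ℤ if s = n−1. -/

import Mathlib

/-- The indefinite quadratic form `b_{s,n}(z,z)`. -/
noncomputable def bq (n s : ℕ) (z : Fin n → ℂ) : ℝ :=
  ∑ j : Fin n, (if (j : ℕ) < s then (-1 : ℝ) else 1) * Complex.normSq (z j)

/-- The `G_λ`-orbit relation on `U₊ = {z : b_{s,n}(z,z) > 0}`. -/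
def orbRelPlus (n s : ℕ) (lam : ℝ)
    (z z' : {z : Fin n → ℂ // 0 < bq n s z}) : Prop :=
  ∃ m : ℤ, (z' : Fin n → ℂ) = (lam ^ m : ℝ) • (z : Fin n → ℂ)

open scoped unitInterval ContinuousMap

theorem IsQuotientCoveringMap.nonempty_fundamentalGroup_mulEquiv {E X G : Type*}
    [TopologicalSpace E] [TopologicalSpace X] [SimplyConnectedSpace E] [CommGroup G]
    [MulAction G E] {p : E → X} (hp : IsQuotientCoveringMap p G) (x : X) :
    Nonempty (FundamentalGroup X x ≃* G) := by
  obtain ⟨e, he⟩ := hp.surjective x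
  exact ⟨(hp.fundamentalGroupEquiv ⟨e, he⟩).trans (MulEquiv.inv' G).symm⟩

section ComplementOfZero

variable {V : Type*} [NormedAddCommGroup V] [NormedSpace ℝ V]

theorem contDiff_sum_bernstein_smul (f : C(I, V)) (N : ℕ) :
    ContDiff ℝ 1 (fun t : ℝ ↦ ∑ k : Fin (N + 1),
      ((N.choose k : ℝ) * t ^ (k : ℕ) * (1 - t) ^ (N - (k : ℕ))) • f (bernstein.z k)) := by
  fun_prop

theorem exists_contDiff_path_homotopic {x : {v : V // v ≠ 0}} (γ : Path x x) :
    ∃ (p : Path x x) (q : ℝ → V), ContDiff ℝ 1 q ∧ (∀ t : I, (p t : V) = q t) ∧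
      γ.Homotopic p := by
  let f : C(I, V) := ⟨fun t ↦ (γ t : V), by fun_prop⟩
  obtain ⟨t₀, ht₀⟩ := isCompact_univ.exists_isMinOn (Set.univ_nonempty (α := I))
    (f := fun t ↦ ‖f t‖) (by fun_prop)
  have hδ : 0 < ‖f t₀‖ := norm_pos_iff.mpr (γ t₀).2
  have hmin (t : I) : ‖f t₀‖ ≤ ‖f t‖ := ht₀.2 (Set.mem_univ t)
  obtain ⟨N, hN, hN0⟩ := ((Metric.tendsto_nhds.mp (bernsteinApproximation_uniform f) _ hδ).and
    (Filter.eventually_ne_atTop 0)).exists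
  set g := bernsteinApproximation N f with hg
  have hclose (t : I) : ‖g t - f t‖ < ‖f t₀‖ := by
    rw [← dist_eq_norm]
    exact (ContinuousMap.dist_apply_le_dist t).trans_lt hN
  have hseg (s t : I) : f t + (s : ℝ) • (g t - f t) ≠ 0 := by
    intro h
    have h1 : ‖f t‖ = (s : ℝ) * ‖g t - f t‖ := by
      simpa [norm_smul, abs_of_nonneg s.2.1] using congrArg norm (eq_neg_of_add_eq_zero_left h)
    nlinarith [hclose t, hmin t, s.2.1, s.2.2, norm_nonneg (g t - f t)]
  have hg0 : g 0 = f 0 := by simp [hg]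
  have hg1 : g 1 = f 1 := by simp [hg, hN0]
  let p : Path x x :=
    { toFun := fun t ↦ ⟨g t, by simpa using hseg 1 t⟩
      continuous_toFun := by fun_prop
      source' := Subtype.ext (by simp [hg0, f])
      target' := Subtype.ext (by simp [hg1, f]) }
  refine ⟨p, _, contDiff_sum_bernstein_smul f N, fun t ↦ ?_, ⟨?_⟩⟩
  · simp only [p, hg, Path.coe_mk', ContinuousMap.coe_mk, bernsteinApproximation.apply,
      bernstein_apply]
  · exact
    { toFun := fun st ↦ ⟨f st.2 + (st.1 : ℝ) • (g st.2 - f st.2), hseg st.1 st.2⟩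
      continuous_toFun := by fun_prop
      map_zero_left := fun t ↦ Subtype.ext (by simp [f])
      map_one_left := fun t ↦ Subtype.ext (by simp [p])
      prop' := by
        rintro s t (rfl | rfl)
        · exact Subtype.ext (by simp [hg0, f])
        · exact Subtype.ext (by simp [hg1, f]) }

theorem starConvex_compl_ray {v : V} (hv : v ≠ 0) :
    StarConvex ℝ v {w : V | ∀ t : ℝ, 0 ≤ t → w ≠ -(t • v)} := by
  intro w hw a b ha hb hab t ht h
  rcases hb.eq_or_lt with rfl | hb
  · obtain rfl : a = 1 := by linarith
    have : (1 + t) • v = 0 := by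
      rw [add_smul, ← eq_neg_iff_add_eq_zero]
      simpa using h
    rcases smul_eq_zero.mp this with h | h
    · linarith
    · exact hv h
  · refine hw (b⁻¹ * (t + a)) (by positivity) ?_
    have : b • w = -((t + a) • v) := by
      rw [add_smul, neg_add, ← h]; abel
    rw [mul_smul, ← smul_neg, ← this, inv_smul_smul₀ hb.ne']

theorem simplyConnectedSpace_ne_zero [FiniteDimensional ℝ V] (hV : 2 < Module.finrank ℝ V) :
    SimplyConnectedSpace {v : V // v ≠ 0} := by
  rw [simply_connected_iff_loops_nullhomotopic]
  refine ⟨isPathConnected_iff_pathConnectedSpace.mp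
    (isPathConnected_compl_singleton_of_one_lt_rank ?_ (0 : V)), fun x γ ↦ ?_⟩
  · rw [← Module.finrank_eq_rank]
    exact_mod_cast (by omega : 1 < Module.finrank ℝ V)
  obtain ⟨p, q, hq, hpq, hγp⟩ := exists_contDiff_path_homotopic γ
  refine hγp.trans ?_
  have hcone : ContDiff ℝ 1 (fun y : ℝ × ℝ ↦ y.1 • q y.2) := by fun_prop
  obtain ⟨v, hv⟩ := (hcone.dense_compl_range_of_finrank_lt_finrank (by simpa using hV)).nonempty
  have hv' (s t : ℝ) : s • q t ≠ v := fun h ↦ hv ⟨(s, t), h⟩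
  have hv0 : v ≠ 0 := by simpa using (hv' 0 0).symm
  set S : Set V := {w : V | ∀ t : ℝ, 0 ≤ t → w ≠ -(t • v)} with hS
  have hpS (t : I) : (p t : V) ∈ S := by
    intro s hs h
    rcases hs.eq_or_lt with rfl | hs
    · exact (p t).2 (by simpa using h)
    · refine hv' (-s⁻¹) t ?_
      rw [← hpq, h, neg_smul_neg, inv_smul_smul₀ hs.ne']
  have hxS : (x : V) ∈ S := by simpa using hpS 0
  have : ContractibleSpace S := (starConvex_compl_ray hv0).contractibleSpace ⟨x, hxS⟩
  let p' : Path (⟨x, hxS⟩ : S) ⟨x, hxS⟩ :=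
    { toFun := fun t ↦ ⟨p t, hpS t⟩
      continuous_toFun := by fun_prop
      source' := by simp
      target' := by simp }
  let ι : C(S, {v : V // v ≠ 0}) :=
    ⟨fun w ↦ ⟨w, by simpa using w.2 0 le_rfl⟩, by fun_prop⟩
  exact (SimplyConnectedSpace.paths_homotopic p' (Path.refl _)).map ι

end ComplementOfZero

section IndefiniteForm

variable {n s : ℕ} {lam : ℝ}

theorem continuous_bq : Continuous (bq n s) := by
  unfold bq
  have := Complex.continuous_normSq
  fun_prop

theorem bq_smul (c : ℂ) (z : Fin n → ℂ) : bq n s (c • z) = Complex.normSq c * bq n s z := by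
  simp only [bq, Finset.mul_sum, Pi.smul_apply, smul_eq_mul, Complex.normSq_mul]
  exact Finset.sum_congr rfl fun j _ ↦ by ring

theorem bq_real_smul (c : ℝ) (z : Fin n → ℂ) : bq n s (c • z) = c ^ 2 * bq n s z := by
  have : c • z = (c : ℂ) • z := by ext; simp
  rw [this, bq_smul, Complex.normSq_ofReal, sq]

theorem bq_le_bq {z w : Fin n → ℂ}
    (hneg : ∀ j : Fin n, (j : ℕ) < s → Complex.normSq (w j) ≤ Complex.normSq (z j))
    (hpos : ∀ j : Fin n, ¬ (j : ℕ) < s → Complex.normSq (z j) ≤ Complex.normSq (w j)) :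
    bq n s z ≤ bq n s w := by
  refine Finset.sum_le_sum fun j _ ↦ ?_
  split_ifs with h
  · linarith [hneg j h]
  · linarith [hpos j h]

theorem exists_ne_zero_of_bq_pos {z : Fin n → ℂ} (hz : 0 < bq n s z) :
    ∃ j : Fin n, ¬ (j : ℕ) < s ∧ z j ≠ 0 := by
  by_contra! h
  refine hz.not_ge (Finset.sum_nonpos fun j _ ↦ ?_)
  split_ifs with hj
  · linarith [Complex.normSq_nonneg (z j)]
  · simp [h j (by omega)]

theorem ne_zero_of_bq_pos {z : Fin n → ℂ} (hz : 0 < bq n s z) : z ≠ 0 := by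
  obtain ⟨j, -, hj⟩ := exists_ne_zero_of_bq_pos hz
  exact fun h ↦ hj (by simp [h])

theorem bq_pos_of_forall_eq_zero {z : Fin n → ℂ} (hneg : ∀ j : Fin n, (j : ℕ) < s → z j = 0)
    (hz : z ≠ 0) : 0 < bq n s z := by
  obtain ⟨i, hi⟩ := Function.ne_iff.mp hz
  have hi' : ¬ (i : ℕ) < s := fun h ↦ hi (hneg i h)
  refine Finset.sum_pos' (fun j _ ↦ ?_) ⟨i, Finset.mem_univ i, ?_⟩
  · split_ifs with hj
    · simp [hneg j hj]
    · linarith [Complex.normSq_nonneg (z j)]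
  · simpa [hi'] using hi

/-- The set of positive vectors retracts by deformation onto its vectors with vanishing
negative coordinates. -/
noncomputable def positiveHomotopyEquiv (n s : ℕ) :
    {z : Fin n → ℂ // 0 < bq n s z} ≃ₕ {w : {j : Fin n // ¬ (j : ℕ) < s} → ℂ // w ≠ 0} where
  toFun := ⟨fun z ↦ ⟨fun j ↦ z.1 j.1, by
    obtain ⟨j, hj, hz⟩ := exists_ne_zero_of_bq_pos z.2
    exact fun h ↦ hz (congrFun h ⟨j, hj⟩)⟩,
    by exact (continuous_pi fun j ↦
      (continuous_apply j.1).comp continuous_subtype_val).subtype_mk _⟩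
  invFun := ⟨fun w ↦ ⟨fun j ↦ if h : (j : ℕ) < s then 0 else w.1 ⟨j, h⟩, by
    refine bq_pos_of_forall_eq_zero (fun j hj ↦ by simp [hj]) ?_
    obtain ⟨j, hj⟩ := Function.ne_iff.mp w.2
    exact fun h ↦ hj (by simpa [j.2] using congrFun h j.1)⟩, by
    refine Continuous.subtype_mk (continuous_pi fun j ↦ ?_) _
    split_ifs with h
    · exact continuous_const
    · exact (continuous_apply _).comp continuous_subtype_val⟩
  left_inv := ⟨
    { toFun := fun tz ↦ ⟨fun j ↦ if (j : ℕ) < s then (tz.1 : ℝ) • tz.2.1 j else tz.2.1 j, by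
        refine tz.2.2.trans_le (bq_le_bq (fun j hj ↦ ?_) fun j hj ↦ by simp [hj])
        have h0 := tz.1.2.1
        have h1 := tz.1.2.2
        simp only [hj, if_true, Complex.real_smul, Complex.normSq_mul, Complex.normSq_ofReal]
        exact mul_le_of_le_one_left (Complex.normSq_nonneg _) (by nlinarith)⟩
      continuous_toFun := by
        refine Continuous.subtype_mk (continuous_pi fun j ↦ ?_) _
        have hj : Continuous fun tz : I × {z : Fin n → ℂ // 0 < bq n s z} ↦ tz.2.1 j :=
          (continuous_apply j).comp (continuous_subtype_val.comp continuous_snd)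
        split_ifs
        · exact (continuous_subtype_val.comp continuous_fst).smul hj
        · exact hj
      map_zero_left := fun z ↦ by ext j; simp
      map_one_left := fun z ↦ by ext j; simp }⟩
  right_inv := by
    convert ContinuousMap.Homotopic.refl
      (ContinuousMap.id {w : {j : Fin n // ¬ (j : ℕ) < s} → ℂ // w ≠ 0})
    ext w j : 3
    simp [j.2]

theorem simplyConnectedSpace_bq_pos (hs : s < n - 1) :
    SimplyConnectedSpace {z : Fin n → ℂ // 0 < bq n s z} := by
  have : SimplyConnectedSpace {w : {j : Fin n // ¬ (j : ℕ) < s} → ℂ // w ≠ 0} := by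
    refine simplyConnectedSpace_ne_zero ?_
    have hcard : 1 < Fintype.card {j : Fin n // ¬ (j : ℕ) < s} :=
      Fintype.one_lt_card_iff.mpr ⟨⟨⟨s, by omega⟩, by simp⟩, ⟨⟨s + 1, by omega⟩, by simp⟩, by simp⟩
    rw [Module.finrank_pi_fintype]
    simp only [Complex.finrank_real_complex, Finset.sum_const, Finset.card_univ, smul_eq_mul]
    omega
  exact (positiveHomotopyEquiv n s).simplyConnectedSpace

theorem quot_mk_eq_iff (hlam0 : 0 < lam) {z w : {z : Fin n → ℂ // 0 < bq n s z}} :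
    Quot.mk (orbRelPlus n s lam) z = Quot.mk (orbRelPlus n s lam) w ↔ orbRelPlus n s lam z w := by
  refine Equivalence.quot_mk_eq_iff ⟨fun z ↦ ⟨0, by simp⟩, ?_, ?_⟩ z w
  · rintro z w ⟨m, hm⟩
    refine ⟨-m, ?_⟩
    rw [hm, smul_smul, ← zpow_add₀ hlam0.ne']
    simp
  · rintro z w u ⟨m, hm⟩ ⟨k, hk⟩
    exact ⟨k + m, by rw [hk, hm, smul_smul, ← zpow_add₀ hlam0.ne']⟩

/-- The action of `ℤ` on the positive vectors by powers of the dilation by `lam`. -/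
noncomputable abbrev dilationAction (n s : ℕ) (hlam0 : 0 < lam) :
    MulAction (Multiplicative ℤ) {z : Fin n → ℂ // 0 < bq n s z} where
  smul g z := ⟨(lam ^ g.toAdd : ℝ) • z.1, by
    have := z.2
    have := zpow_pos hlam0 g.toAdd
    rw [bq_real_smul]
    positivity⟩
  one_smul z := Subtype.ext (by
    change (lam ^ (0 : ℤ) : ℝ) • z.1 = z.1
    simp)
  mul_smul g h z := Subtype.ext (by
    change (lam ^ (g.toAdd + h.toAdd) : ℝ) • z.1 = (lam ^ g.toAdd : ℝ) • (lam ^ h.toAdd : ℝ) • z.1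
    rw [smul_smul, zpow_add₀ hlam0.ne'])

theorem isQuotientCoveringMap_dilation (hlam0 : 0 < lam) (hlam1 : lam < 1) :
    letI := dilationAction n s hlam0
    IsQuotientCoveringMap (Quot.mk (orbRelPlus n s lam)) (Multiplicative ℤ) := by
  let := dilationAction n s hlam0
  have hsmul (g : Multiplicative ℤ) (z : {z : Fin n → ℂ // 0 < bq n s z}) :
      (g • z).1 = (lam ^ g.toAdd : ℝ) • z.1 := rfl
  refine
    { isQuotientMap_quot_mk with
      continuous_const_smul := fun g ↦ Continuous.subtype_mk (by fun_prop) _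
      apply_eq_iff_mem_orbit := fun {z w} ↦ ?_
      disjoint := fun e ↦ ?_ }
  · rw [eq_comm, quot_mk_eq_iff hlam0]
    constructor
    · rintro ⟨m, hm⟩
      exact ⟨Multiplicative.ofAdd m, Subtype.ext hm.symm⟩
    · rintro ⟨g, hg⟩
      exact ⟨g.toAdd, by rw [← hg]; rfl⟩
  · have hnorm (z : {z : Fin n → ℂ // 0 < bq n s z}) : ‖z.1‖ ≠ 0 :=
      norm_ne_zero_iff.mpr (ne_zero_of_bq_pos z.2)
    have hlog : Real.log lam < 0 := Real.log_neg hlam0 hlam1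
    have hcont : Continuous fun z : {z : Fin n → ℂ // 0 < bq n s z} ↦ Real.log ‖z.1‖ :=
      (by fun_prop : Continuous fun z : {z : Fin n → ℂ // 0 < bq n s z} ↦ ‖z.1‖).log hnorm
    refine ⟨_, hcont.continuousAt.preimage_mem_nhds
      (Metric.ball_mem_nhds _ (by linarith : 0 < -Real.log lam / 2)), ?_⟩
    rintro g ⟨_, ⟨z, hz, rfl⟩, hgz⟩
    simp only [Set.mem_preimage, Metric.mem_ball, hsmul, norm_smul, Real.dist_eq] at hz hgz
    rw [Real.norm_of_nonneg (zpow_pos hlam0 _).le, Real.log_mul (zpow_pos hlam0 _).ne' (hnorm z),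
      Real.log_zpow] at hgz
    rw [abs_lt] at hz hgz
    have h1 : (g.toAdd : ℝ) < 1 := by nlinarith
    have h2 : (-1 : ℝ) < g.toAdd := by nlinarith
    have h3 : g.toAdd = 0 := by
      have : g.toAdd < 1 := by exact_mod_cast h1
      have : -1 < g.toAdd := by exact_mod_cast h2
      omega
    exact h3

end IndefiniteForm

section CodimensionOne

variable {n s : ℕ} {lam : ℝ}

/-- The positive vectors whose coordinate at `i` is normalized to `1`. -/
def normalizedPositive (n s : ℕ) (i : Fin n) : Set (Fin n → ℂ) :=
  {z | z i = 1 ∧ 0 < bq n s z}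

theorem contractibleSpace_normalizedPositive {i : Fin n} (hi : ∀ j : Fin n, ¬ (j : ℕ) < s ↔ j = i) :
    ContractibleSpace (normalizedPositive n s i) := by
  have his : ¬ (i : ℕ) < s := (hi i).mpr rfl
  have hne : Pi.single i 1 ∈ normalizedPositive n s i := by
    refine ⟨by simp, bq_pos_of_forall_eq_zero (fun j hj ↦ ?_) (by simp)⟩
    exact Pi.single_eq_of_ne (fun h ↦ his (by rwa [← h])) _
  refine StarConvex.contractibleSpace (x := (Pi.single i 1 : Fin n → ℂ)) (fun z hz a b ha hb hab ↦ ?_) ⟨_, hne⟩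
  have hzi : (a • (Pi.single i 1 : Fin n → ℂ) + b • z) i = 1 := by
    simp only [Pi.add_apply, Pi.smul_apply, Pi.single_eq_same, hz.1, ← add_smul, hab, one_smul]
  refine ⟨hzi, hz.2.trans_le (bq_le_bq (fun j hj ↦ ?_) fun j hj ↦ ?_)⟩
  · have hji : j ≠ i := fun h ↦ his (by rwa [← h])
    simp only [Pi.add_apply, Pi.smul_apply, Pi.single_eq_of_ne hji, smul_zero, zero_add,
      Complex.real_smul, Complex.normSq_mul, Complex.normSq_ofReal]
    exact mul_le_of_le_one_left (Complex.normSq_nonneg _) (by nlinarith)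
  · rw [(hi j).mp hj, hz.1, hzi]

theorem apply_ne_zero_of_bq_pos {i : Fin n} (hi : ∀ j : Fin n, ¬ (j : ℕ) < s ↔ j = i)
    {z : Fin n → ℂ} (hz : 0 < bq n s z) : z i ≠ 0 := by
  obtain ⟨j, hj, hzj⟩ := exists_ne_zero_of_bq_pos hz
  rwa [(hi j).mp hj] at hzj

/-- With a single positive coordinate, a positive vector is uniquely a multiple of a
normalized one. -/
noncomputable def polarHomeomorph {i : Fin n} (hi : ∀ j : Fin n, ¬ (j : ℕ) < s ↔ j = i) :
    {w : ℂ // w ≠ 0} × normalizedPositive n s i ≃ₜ {z : Fin n → ℂ // 0 < bq n s z} where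
  toFun x := ⟨x.1.1 • x.2.1, by
    rw [bq_smul]
    exact mul_pos (Complex.normSq_pos.mpr x.1.2) x.2.2.2⟩
  invFun z := (⟨z.1 i, apply_ne_zero_of_bq_pos hi z.2⟩, ⟨(z.1 i)⁻¹ • z.1, by
    have hz := apply_ne_zero_of_bq_pos hi z.2
    refine ⟨by simp [hz], ?_⟩
    rw [bq_smul]
    exact mul_pos (Complex.normSq_pos.mpr (inv_ne_zero hz)) z.2⟩)
  left_inv x := by
    have hx := x.2.2.1
    ext j <;> simp [hx, x.1.2]
  right_inv z := by
    have hz := apply_ne_zero_of_bq_pos hi z.2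
    ext j
    simp [hz]
  continuous_toFun := by fun_prop
  continuous_invFun := by
    have hcoord : Continuous fun z : {z : Fin n → ℂ // 0 < bq n s z} ↦ z.1 i :=
      (continuous_apply i).comp continuous_subtype_val
    exact (hcoord.subtype_mk _).prodMk (((hcoord.inv₀ fun z ↦
      apply_ne_zero_of_bq_pos hi z.2).smul continuous_subtype_val).subtype_mk _)

/-- The action of `ℤ × ℤ` on `ℂ × Y` by translations of the first factor along the lattice
spanned by `log lam` and the period of the exponential. -/
noncomputable abbrev latticeAction (lam : ℝ) (Y : Type*) :
    MulAction (Multiplicative ℤ × Multiplicative ℤ) (ℂ × Y) where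
  smul g x := (x.1 + (g.1.toAdd * Real.log lam + g.2.toAdd * (2 * Real.pi * Complex.I)), x.2)
  one_smul x := Prod.ext (by
    change x.1 + (((0 : ℤ) : ℂ) * Real.log lam + ((0 : ℤ) : ℂ) * (2 * Real.pi * Complex.I)) = x.1
    simp) rfl
  mul_smul g h x := Prod.ext (by
    change x.1 + (((g.1.toAdd + h.1.toAdd : ℤ) : ℂ) * Real.log lam +
        ((g.2.toAdd + h.2.toAdd : ℤ) : ℂ) * (2 * Real.pi * Complex.I)) =
      (x.1 + (h.1.toAdd * Real.log lam + h.2.toAdd * (2 * Real.pi * Complex.I))) +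
        (g.1.toAdd * Real.log lam + g.2.toAdd * (2 * Real.pi * Complex.I))
    push_cast
    ring) rfl

/-- The universal covering of the positive vectors with a single positive coordinate. -/
noncomputable def expCover {i : Fin n} (hi : ∀ j : Fin n, ¬ (j : ℕ) < s ↔ j = i)
    (x : ℂ × normalizedPositive n s i) : {z : Fin n → ℂ // 0 < bq n s z} :=
  polarHomeomorph hi (⟨Complex.exp x.1, Complex.exp_ne_zero _⟩, x.2)

theorem coe_expCover {i : Fin n} (hi : ∀ j : Fin n, ¬ (j : ℕ) < s ↔ j = i)
    (x : ℂ × normalizedPositive n s i) : (expCover hi x).1 = Complex.exp x.1 • x.2.1 := rfl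

theorem isOpenQuotientMap_expCover {i : Fin n} (hi : ∀ j : Fin n, ¬ (j : ℕ) < s ↔ j = i) :
    IsOpenQuotientMap (expCover hi) := by
  have hexp : IsOpenQuotientMap fun z : ℂ ↦ (⟨_, z.exp_ne_zero⟩ : {z : ℂ // z ≠ 0}) :=
    Complex.isAddQuotientCoveringMap_exp.isOpenQuotientMap
  exact (polarHomeomorph hi).isOpenQuotientMap.comp (hexp.prodMap .id)

theorem cexp_int_mul_log (hlam0 : 0 < lam) (m : ℤ) :
    Complex.exp (m * Real.log lam) = (lam ^ m : ℝ) := by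
  rw [Complex.exp_int_mul, ← Complex.ofReal_exp, Real.exp_log hlam0, Complex.ofReal_zpow]

theorem isQuotientCoveringMap_lattice (hlam0 : 0 < lam) (hlam1 : lam < 1) {i : Fin n}
    (hi : ∀ j : Fin n, ¬ (j : ℕ) < s ↔ j = i) :
    letI := latticeAction lam (normalizedPositive n s i)
    IsQuotientCoveringMap (Quot.mk (orbRelPlus n s lam) ∘ expCover hi)
      (Multiplicative ℤ × Multiplicative ℤ) := by
  let := latticeAction lam (normalizedPositive n s i)
  have hsmul (g : Multiplicative ℤ × Multiplicative ℤ) (x : ℂ × normalizedPositive n s i) :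
      g • x = (x.1 + (g.1.toAdd * Real.log lam + g.2.toAdd * (2 * Real.pi * Complex.I)), x.2) :=
    rfl
  have hlog : Real.log lam < 0 := Real.log_neg hlam0 hlam1
  refine
    { isQuotientMap_quot_mk.comp (isOpenQuotientMap_expCover hi).isQuotientMap with
      continuous_const_smul := fun g ↦ ?_
      apply_eq_iff_mem_orbit := fun {x y} ↦ ?_
      disjoint := fun e ↦ ?_ }
  · simp only [hsmul]
    fun_prop
  · rw [eq_comm, Function.comp_apply, Function.comp_apply, quot_mk_eq_iff hlam0]
    constructor
    · rintro ⟨m, hm⟩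
      have hm' : Complex.exp x.1 • x.2.1 = Complex.exp (y.1 + m * Real.log lam) • y.2.1 := by
        rw [← coe_expCover hi x, hm, coe_expCover, Complex.exp_add, cexp_int_mul_log hlam0]
        ext j
        simp [mul_left_comm, mul_assoc]
      have h1 : Complex.exp x.1 = Complex.exp (y.1 + m * Real.log lam) := by
        simpa [x.2.2.1, y.2.2.1] using congrFun hm' i
      obtain ⟨k, hk⟩ := Complex.exp_eq_exp_iff_exists_int.mp h1
      refine ⟨(Multiplicative.ofAdd m, Multiplicative.ofAdd k), Prod.ext ?_ (Subtype.ext ?_)⟩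
      · simp only [hsmul, toAdd_ofAdd, hk]
        ring
      · rw [h1] at hm'
        exact (smul_right_injective _ (Complex.exp_ne_zero _) hm').symm
    · rintro ⟨g, rfl⟩
      refine ⟨g.1.toAdd, ?_⟩
      simp only [hsmul, coe_expCover, Complex.exp_add, cexp_int_mul_log hlam0,
        Complex.exp_int_mul_two_pi_mul_I]
      ext j
      simp [mul_left_comm, mul_assoc]
  · refine ⟨(fun x ↦ x.1.re) ⁻¹' Metric.ball e.1.re (-Real.log lam / 2) ∩
      (fun x ↦ x.1.im) ⁻¹' Metric.ball e.1.im Real.pi, Filter.inter_mem ?_ ?_, ?_⟩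
    · exact (by fun_prop : Continuous fun x : ℂ × normalizedPositive n s i ↦
        x.1.re).continuousAt.preimage_mem_nhds (Metric.ball_mem_nhds _ (by linarith))
    · exact (by fun_prop : Continuous fun x : ℂ × normalizedPositive n s i ↦
        x.1.im).continuousAt.preimage_mem_nhds (Metric.ball_mem_nhds _ Real.pi_pos)
    rintro g ⟨_, ⟨x, hx, rfl⟩, hgx⟩
    have eq_zero {k : ℤ} {a : ℝ} (ha : 0 < a) (h1 : k * a < a) (h2 : -a < k * a) : k = 0 := by
      have h3 : (k : ℝ) < 1 := by nlinarith
      have h4 : (-1 : ℝ) < k := by nlinarith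
      have : k < 1 := by exact_mod_cast h3
      have : -1 < k := by exact_mod_cast h4
      omega
    simp only [Set.mem_inter_iff, Set.mem_preimage, Metric.mem_ball, hsmul, Real.dist_eq,
      abs_lt] at hx hgx
    simp at hgx
    obtain ⟨⟨_, _⟩, _, _⟩ := hx
    obtain ⟨⟨_, _⟩, _, _⟩ := hgx
    have h1 : g.1.toAdd = 0 := eq_zero (a := -Real.log lam) (by linarith) (by linarith)
      (by linarith)
    have h2 : g.2.toAdd = 0 := eq_zero (a := 2 * Real.pi) (by positivity) (by linarith)
      (by linarith)
    exact Prod.ext h1 h2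

end CodimensionOne

/-- for `Ω₊ = {b_{s,n}(z,z) > 0}/G_λ` (quotient topology) and any basepoint
`x`, the fundamental group `π₁(Ω₊, x)` is `ℤ` if `s < n-1` and `ℤ × ℤ` if `s = n-1`. -/
theorem stmt_12 (n s : ℕ) (hn : 2 ≤ n) (hs : 0 < s) (hsn : s < n)
    (lam : ℝ) (hlam0 : 0 < lam) (hlam1 : lam < 1) :
    ∀ x : Quot (orbRelPlus n s lam),
      (s < n - 1 →
        Nonempty (FundamentalGroup (Quot (orbRelPlus n s lam)) x ≃* Multiplicative ℤ)) ∧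
      (s = n - 1 →
        Nonempty (FundamentalGroup (Quot (orbRelPlus n s lam)) x ≃*
          (Multiplicative ℤ × Multiplicative ℤ))) := by
  refine fun x ↦ ⟨fun h ↦ ?_, fun h ↦ ?_⟩
  · let := dilationAction n s hlam0
    have := simplyConnectedSpace_bq_pos h
    exact (isQuotientCoveringMap_dilation hlam0 hlam1).nonempty_fundamentalGroup_mulEquiv x
  · have hi (j : Fin n) : ¬ (j : ℕ) < s ↔ j = ⟨s, hsn⟩ := by
      rw [Fin.ext_iff]
      dsimp only
      omega
    let := latticeAction lam (normalizedPositive n s ⟨s, hsn⟩)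
    have := contractibleSpace_normalizedPositive hi
    exact (isQuotientCoveringMap_lattice hlam0 hlam1 hi).nonempty_fundamentalGroup_mulEquiv x
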